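/- Assume that in the affine plane, for any two points R and Q there is exactly one translation taking R to Q. Then every trace-preserving endomorphism α of the translation group Tr with α different from the zero endomorphism has a two-sided inverse under composition: there exists a trace-preserving endomorphism β, different from the zero endomorphism, such that α ∘ β = β ∘ α = 1, where 1 is the identity endomorphism. -/

import Mathlib

/-- An affine plane: a type `P` of points together with a set of subsets of `P`
(the lines) satisfying the three axioms of affine planes. -/
structure AffinePlane (P : Type*) where
  lines : Set (Set P)
  /-- A1: any two distinct points lie on exactly one line. -/
  a1 : ∀ A B : P, A ≠ B → ∃! ℓ : Set P, ℓ ∈ lines ∧ A ∈ ℓ ∧ B ∈ ℓ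
  /-- A2: for a point `A` not on a line `ℓ` there is exactly one line through `A`
  disjoint from `ℓ`. -/
  a2 : ∀ (A : P) (ℓ : Set P), ℓ ∈ lines → A ∉ ℓ →
    ∃! m : Set P, m ∈ lines ∧ A ∈ m ∧ m ∩ ℓ = ∅
  /-- A3: there are three points not all on one line. -/
  a3 : ∃ A B C : P, ∀ ℓ ∈ lines, ¬(A ∈ ℓ ∧ B ∈ ℓ ∧ C ∈ ℓ)

namespace AffinePlane

variable {P : Type*}

/-- Two lines are parallel if they are equal or disjoint. -/
def Parallel (π : AffinePlane P) (ℓ m : Set P) : Prop :=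
  ℓ = m ∨ ℓ ∩ m = ∅

/-- A collineation is a bijection of the points mapping lines to lines. -/
def IsCollineation (π : AffinePlane P) (f : P ≃ P) : Prop :=
  ∀ ℓ ∈ π.lines, f '' ℓ ∈ π.lines

/-- A dilation is a collineation `f` such that for all distinct points `A`, `B`,
the line through `f A` and `f B` is parallel to the line through `A` and `B`. -/
def IsDilation (π : AffinePlane P) (f : P ≃ P) : Prop :=
  IsCollineation π f ∧
  ∀ A B : P, A ≠ B → ∀ ℓ m : Set P,
    (ℓ ∈ π.lines ∧ f A ∈ ℓ ∧ f B ∈ ℓ) →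
    (m ∈ π.lines ∧ A ∈ m ∧ B ∈ m) →
    Parallel π ℓ m

/-- A translation is a dilation which is the identity or has no fixed point. -/
def IsTranslation (π : AffinePlane P) (f : P ≃ P) : Prop :=
  IsDilation π f ∧ (f = Equiv.refl P ∨ ∀ A : P, f A ≠ A)

/-- An endomorphism of the translation group `Tr` of the affine plane `π`,
viewed as a map on bijections: it sends translations to translations and
satisfies `α (σ ∘ τ) = α σ ∘ α τ` on translations (here `τ.trans σ` is the
composite `σ ∘ τ`, applying `τ` first). -/
def IsEndo (π : AffinePlane P) (α : (P ≃ P) → (P ≃ P)) : Prop :=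
  (∀ σ : P ≃ P, IsTranslation π σ → IsTranslation π (α σ)) ∧
  (∀ σ τ : P ≃ P, IsTranslation π σ → IsTranslation π τ →
    α (τ.trans σ) = (α τ).trans (α σ))

/-- A trace-preserving endomorphism of the translation group: an endomorphism
`α` such that for every translation `σ` with `α σ ≠ id` and every point `A`,
the point `α σ A` lies on (any, hence the unique) line through `A` and `σ A`. -/
def IsTracePreserving (π : AffinePlane P) (α : (P ≃ P) → (P ≃ P)) : Prop :=
  IsEndo π α ∧
  ∀ σ : P ≃ P, IsTranslation π σ → α σ ≠ Equiv.refl P →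
    ∀ (A : P) (ℓ : Set P), ℓ ∈ π.lines → A ∈ ℓ → σ A ∈ ℓ → (α σ) A ∈ ℓ

/-- Pointwise sum of two maps: `(α + β) σ = α σ ∘ β σ` (apply `β σ` first). -/
def addE (α β : (P ≃ P) → (P ≃ P)) : (P ≃ P) → (P ≃ P) :=
  fun σ => (β σ).trans (α σ)

/-- Composite of two maps: `(α ∘ β) σ = α (β σ)`. -/
def compE (α β : (P ≃ P) → (P ≃ P)) : (P ≃ P) → (P ≃ P) :=
  fun σ => α (β σ)

/-- The zero endomorphism, sending every translation to the identity. -/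
def zeroE : (P ≃ P) → (P ≃ P) := fun _ => Equiv.refl P

/-- The identity endomorphism, sending every translation to itself. -/
def oneE : (P ≃ P) → (P ≃ P) := fun σ => σ

/-- Negation: `(-α) σ = (α σ)⁻¹`. -/
def negE (α : (P ≃ P) → (P ≃ P)) : (P ≃ P) → (P ≃ P) :=
  fun σ => (α σ).symm

/-- `α` is different from the zero endomorphism (as a map on translations). -/
def NonzeroE (π : AffinePlane P) (α : (P ≃ P) → (P ≃ P)) : Prop :=
  ∃ σ : P ≃ P, IsTranslation π σ ∧ α σ ≠ Equiv.refl P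

theorem Parallel.symm {π : AffinePlane P} {ℓ m : Set P} (h : Parallel π ℓ m) :
    Parallel π m ℓ :=
  h.imp Eq.symm fun h => by rwa [Set.inter_comm]

theorem Parallel.eq_of_mem {π : AffinePlane P} {ℓ m : Set P} (h : Parallel π ℓ m) {A : P}
    (hℓ : A ∈ ℓ) (hm : A ∈ m) : ℓ = m := by
  rcases h with h | h
  · exact h
  · exact absurd (h ▸ ⟨hℓ, hm⟩ : A ∈ (∅ : Set P)) (Set.notMem_empty A)

theorem Parallel.trans {π : AffinePlane P} {ℓ m n : Set P} (hℓ : ℓ ∈ π.lines)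
    (hm : m ∈ π.lines) (hn : n ∈ π.lines) (h : Parallel π ℓ m) (h' : Parallel π m n) :
    Parallel π ℓ n := by
  by_cases hd : ℓ ∩ n = ∅
  · exact Or.inr hd
  obtain ⟨A, hAℓ, hAn⟩ := Set.nonempty_iff_ne_empty.mpr hd
  by_cases hAm : A ∈ m
  · exact Or.inl ((h.eq_of_mem hAℓ hAm).trans (h'.eq_of_mem hAm hAn))
  refine Or.inl ((π.a2 A m hm hAm).unique ⟨hℓ, hAℓ, ?_⟩ ⟨hn, hAn, ?_⟩)
  · exact h.resolve_left fun e => hAm (e ▸ hAℓ)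
  · exact h'.symm.resolve_left fun e => hAm (e ▸ hAn)

theorem line_eq (π : AffinePlane P) {ℓ m : Set P} (hℓ : ℓ ∈ π.lines) (hm : m ∈ π.lines)
    {A B : P} (hAB : A ≠ B) (hA : A ∈ ℓ) (hB : B ∈ ℓ) (hA' : A ∈ m) (hB' : B ∈ m) : ℓ = m :=
  (π.a1 A B hAB).unique ⟨hℓ, hA, hB⟩ ⟨hm, hA', hB'⟩

theorem exists_line_through (π : AffinePlane P) {A B : P} (hAB : A ≠ B) :
    ∃ ℓ ∈ π.lines, A ∈ ℓ ∧ B ∈ ℓ := by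
  obtain ⟨ℓ, hℓ, -⟩ := π.a1 A B hAB
  exact ⟨ℓ, hℓ⟩

theorem exists_parallel_through (π : AffinePlane P) (A : P) {ℓ : Set P} (hℓ : ℓ ∈ π.lines) :
    ∃ m ∈ π.lines, A ∈ m ∧ Parallel π m ℓ := by
  by_cases hA : A ∈ ℓ
  · exact ⟨ℓ, hℓ, hA, Or.inl rfl⟩
  · obtain ⟨m, ⟨hm, hAm, hd⟩, -⟩ := π.a2 A ℓ hℓ hA
    exact ⟨m, hm, hAm, Or.inr hd⟩

theorem exists_notMem_line (π : AffinePlane P) {ℓ : Set P} (hℓ : ℓ ∈ π.lines) :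
    ∃ A, A ∉ ℓ := by
  obtain ⟨A, B, C, h⟩ := π.a3
  by_contra! hall
  exact h ℓ hℓ ⟨hall A, hall B, hall C⟩

theorem line_nonempty (π : AffinePlane P) {ℓ : Set P} (hℓ : ℓ ∈ π.lines) : ℓ.Nonempty := by
  by_contra hem
  rw [Set.not_nonempty_iff_eq_empty] at hem
  subst hem
  obtain ⟨A, -⟩ := π.a3
  obtain ⟨m, ⟨hm, hAm, -⟩, hu⟩ := π.a2 A ∅ hℓ (Set.notMem_empty A)
  obtain ⟨W, hW⟩ := exists_notMem_line π hm
  obtain ⟨k, hk, hAk, hWk⟩ := exists_line_through π (show A ≠ W from fun e => hW (e ▸ hAm))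
  exact hW (hu k ⟨hk, hAk, Set.inter_empty k⟩ ▸ hWk)

theorem exists_two_mem_line (π : AffinePlane P) {ℓ : Set P} (hℓ : ℓ ∈ π.lines) :
    ∃ A ∈ ℓ, ∃ B ∈ ℓ, A ≠ B := by
  by_contra! hsub
  obtain ⟨B, hB⟩ := line_nonempty π hℓ
  have hdisj : ∀ m : Set P, B ∉ m → m ∩ ℓ = ∅ := fun m hBm =>
    Set.eq_empty_of_forall_notMem fun X hX => hBm (hsub X hX.2 B hB ▸ hX.1)
  obtain ⟨A, hA⟩ := exists_notMem_line π hℓ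
  have hAB : A ≠ B := fun e => hA (e ▸ hB)
  obtain ⟨m, hm, hAm, hBm⟩ := exists_line_through π hAB
  obtain ⟨C, hC⟩ := exists_notMem_line π hm
  obtain ⟨k, hk, hAk, hCk⟩ := exists_line_through π (show A ≠ C from fun e => hC (e ▸ hAm))
  obtain ⟨n, hn, hBn, hCn⟩ := exists_line_through π (show B ≠ C from fun e => hC (e ▸ hBm))
  have hBk : B ∉ k := fun h => hC (line_eq π hk hm hAB hAk h hAm hBm ▸ hCk)
  have hAn : A ∉ n := fun h => hC (line_eq π hn hm hAB h hBn hAm hBm ▸ hCn)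
  obtain ⟨j, ⟨hj, hAj, hjn⟩, -⟩ := π.a2 A n hn hAn
  have hBj : B ∉ j := fun h => (hjn ▸ ⟨h, hBn⟩ : B ∈ (∅ : Set P))
  have hkj := (π.a2 A ℓ hℓ hA).unique ⟨hk, hAk, hdisj k hBk⟩ ⟨hj, hAj, hdisj j hBj⟩
  exact (hjn ▸ ⟨hkj ▸ hCk, hCn⟩ : C ∈ (∅ : Set P))

theorem IsDilation.comp {π : AffinePlane P} {f g : P ≃ P} (hf : IsDilation π f)
    (hg : IsDilation π g) : IsDilation π (g.trans f) := by
  refine ⟨fun ℓ hℓ => ?_, fun A B hAB ℓ m hℓ hm => ?_⟩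
  · rw [Equiv.coe_trans, Set.image_comp]
    exact hf.1 _ (hg.1 ℓ hℓ)
  · obtain ⟨n, hn⟩ := exists_line_through π (g.injective.ne hAB)
    exact (hf.2 _ _ (g.injective.ne hAB) ℓ n hℓ hn).trans hℓ.1 hn.1 hm.1
      (hg.2 A B hAB n m hn hm)

theorem IsDilation.symm {π : AffinePlane P} {f : P ≃ P} (hf : IsDilation π f) :
    IsDilation π f.symm := by
  refine ⟨fun ℓ hℓ => ?_, fun A B hAB ℓ m hℓ hm => ?_⟩
  · obtain ⟨A, hA, B, hB, hAB⟩ := exists_two_mem_line π hℓ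
    obtain ⟨m, hm, hAm, hBm⟩ := exists_line_through π (f.symm.injective.ne hAB)
    have h : f '' m = ℓ := line_eq π (hf.1 m hm) hℓ hAB
      ⟨_, hAm, f.apply_symm_apply A⟩ ⟨_, hBm, f.apply_symm_apply B⟩ hA hB
    rwa [← h, Equiv.symm_image_image]
  · exact (hf.2 _ _ (f.symm.injective.ne hAB) m ℓ (by simpa using hm) hℓ).symm

theorem isTranslation_refl (π : AffinePlane P) : IsTranslation π (Equiv.refl P) := by
  refine ⟨⟨fun ℓ hℓ => by simpa using hℓ, fun A B hAB ℓ m hℓ hm => Or.inl ?_⟩, Or.inl rfl⟩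
  exact line_eq π hℓ.1 hm.1 hAB hℓ.2.1 hℓ.2.2 hm.2.1 hm.2.2

theorem IsTranslation.symm {π : AffinePlane P} {f : P ≃ P} (hf : IsTranslation π f) :
    IsTranslation π f.symm := by
  refine ⟨hf.1.symm, hf.2.imp (fun h => by rw [h, Equiv.refl_symm]) fun h A hA => h A ?_⟩
  exact (f.symm_apply_eq.mp hA).symm

theorem IsTranslation.apply_ne {π : AffinePlane P} {σ : P ≃ P} (hσ : IsTranslation π σ)
    (h : σ ≠ Equiv.refl P) (A : P) : σ A ≠ A :=
  hσ.2.resolve_left h A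

/-- A line joining a point to its image under a translation is mapped into itself. -/
theorem IsTranslation.mapsTo_trace {π : AffinePlane P} {σ : P ≃ P} (hσ : IsTranslation π σ)
    {ℓ : Set P} (hℓ : ℓ ∈ π.lines) {A B : P} (hA : A ∈ ℓ) (hσA : σ A ∈ ℓ) (hB : B ∈ ℓ) :
    σ B ∈ ℓ := by
  by_cases hAB : A = B
  · exact hAB ▸ hσA
  obtain ⟨m, hm, hAm, hBm⟩ := exists_line_through π (σ.injective.ne hAB)
  have hpar := hσ.1.2 A B hAB m ℓ ⟨hm, hAm, hBm⟩ ⟨hℓ, hA, hB⟩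
  exact hpar.eq_of_mem hAm hσA ▸ hBm

/-- All traces of a translation are parallel. -/
theorem IsTranslation.apply_mem_of_parallel {π : AffinePlane P} {σ : P ≃ P}
    (hσ : IsTranslation π σ) {ℓ m : Set P} (hℓ : ℓ ∈ π.lines) (hm : m ∈ π.lines)
    (hpar : Parallel π m ℓ) {A B : P} (hA : A ∈ ℓ) (hσA : σ A ∈ ℓ) (hB : B ∈ m) :
    σ B ∈ m := by
  by_cases h1 : σ = Equiv.refl P
  · simpa [h1] using hB
  have hfix := hσ.apply_ne h1
  by_cases hBℓ : B ∈ ℓ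
  · have := hpar.eq_of_mem hB hBℓ
    subst this
    exact hσ.mapsTo_trace hm hA hσA hBℓ
  obtain ⟨n, hn, hBn, hσBn⟩ := exists_line_through π (hfix B).symm
  have hd : n ∩ ℓ = ∅ := by
    by_contra hne
    obtain ⟨C, hCn, hCℓ⟩ := Set.nonempty_iff_ne_empty.mpr hne
    have := line_eq π hn hℓ (hfix C).symm hCn (hσ.mapsTo_trace hn hBn hσBn hCn) hCℓ
      (hσ.mapsTo_trace hℓ hA hσA hCℓ)
    exact hBℓ (this ▸ hBn)
  have hd' : m ∩ ℓ = ∅ := hpar.resolve_left fun e => hBℓ (e ▸ hB)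
  rw [(π.a2 B ℓ hℓ hBℓ).unique ⟨hm, hB, hd'⟩ ⟨hn, hBn, hd⟩]
  exact hσBn

theorem IsTranslation.eq_of_apply_eq {π : AffinePlane P}
    (huniq : ∀ R Q : P, ∃! σ : P ≃ P, IsTranslation π σ ∧ σ R = Q) {σ τ : P ≃ P}
    (hσ : IsTranslation π σ) (hτ : IsTranslation π τ) {A : P} (h : σ A = τ A) : σ = τ :=
  (huniq A (τ A)).unique ⟨hσ, h⟩ ⟨hτ, rfl⟩

theorem IsTranslation.comp {π : AffinePlane P}
    (huniq : ∀ R Q : P, ∃! σ : P ≃ P, IsTranslation π σ ∧ σ R = Q) {σ τ : P ≃ P}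
    (hσ : IsTranslation π σ) (hτ : IsTranslation π τ) : IsTranslation π (τ.trans σ) := by
  refine ⟨hσ.1.comp hτ.1, or_iff_not_imp_right.mpr fun h => ?_⟩
  push Not at h
  obtain ⟨A, hA⟩ := h
  have : τ = σ.symm := hτ.eq_of_apply_eq huniq hσ.symm (A := A)
    (σ.eq_symm_apply.mpr hA)
  rw [this, Equiv.symm_trans_self]

theorem IsEndo.map_refl {π : AffinePlane P} {α : (P ≃ P) → (P ≃ P)} (hα : IsEndo π α) :
    α (Equiv.refl P) = Equiv.refl P := by
  have h := hα.2 _ _ (isTranslation_refl π) (isTranslation_refl π)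
  rw [Equiv.refl_trans] at h
  ext A
  exact (α (Equiv.refl P)).injective (DFunLike.congr_fun h A).symm

theorem IsTracePreserving.apply_mem {π : AffinePlane P} {α : (P ≃ P) → (P ≃ P)}
    (hα : IsTracePreserving π α) {σ : P ≃ P} (hσ : IsTranslation π σ) {ℓ m : Set P}
    (hℓ : ℓ ∈ π.lines) (hm : m ∈ π.lines) (hpar : Parallel π m ℓ) {A B : P}
    (hA : A ∈ ℓ) (hσA : σ A ∈ ℓ) (hB : B ∈ m) : (α σ) B ∈ m := by
  by_cases h1 : α σ = Equiv.refl P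
  · simpa [h1] using hB
  · exact (hα.1.1 σ hσ).apply_mem_of_parallel hℓ hm hpar hA (hα.2 σ hσ h1 A ℓ hℓ hA hσA) hB

/-- A trace-preserving endomorphism killing a translation `τ` kills every translation
whose direction differs from that of `τ`. -/
theorem IsTracePreserving.eq_refl_of_direction_ne {π : AffinePlane P}
    (huniq : ∀ R Q : P, ∃! σ : P ≃ P, IsTranslation π σ ∧ σ R = Q)
    {α : (P ≃ P) → (P ≃ P)} (hα : IsTracePreserving π α) {σ τ : P ≃ P}
    (hσ : IsTranslation π σ) (hτ : IsTranslation π τ)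
    (hατ : α τ = Equiv.refl P) {A : P}
    (hind : ∀ ℓ ∈ π.lines, A ∈ ℓ → τ A ∈ ℓ → σ A ∉ ℓ) : α σ = Equiv.refl P := by
  by_contra h1
  have hcomp : α (σ.trans τ) = α σ := by
    rw [hα.1.2 τ σ hτ hσ, hατ, Equiv.trans_refl]
  have hστ := hτ.comp huniq hσ
  have hfix : (α σ) A ≠ A := (hα.1.1 σ hσ).apply_ne h1 A
  have hστ1 : σ.trans τ ≠ Equiv.refl P := fun e => h1 (by rw [← hcomp, e, hα.1.map_refl])
  obtain ⟨k, hk, hAk, hBk⟩ := exists_line_through π (hστ.apply_ne hστ1 A).symm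
  have hαk : (α σ) A ∈ k := by
    have := hα.2 _ hστ (hcomp ▸ h1) A k hk hAk hBk
    rwa [hcomp] at this
  have hσ1 : σ ≠ Equiv.refl P := fun e => h1 (by rw [e, hα.1.map_refl])
  obtain ⟨n, hn, hAn, hσn⟩ := exists_line_through π (hσ.apply_ne hσ1 A).symm
  have hαn := hα.2 σ hσ h1 A n hn hAn hσn
  have hkn := line_eq π hk hn hfix.symm hAk hαk hAn hαn
  subst hkn
  exact hind k hk hAk (hτ.mapsTo_trace hk hσn hBk hAk) hσn

theorem IsTracePreserving.eq_refl_of_map_eq_refl {π : AffinePlane P}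
    (huniq : ∀ R Q : P, ∃! σ : P ≃ P, IsTranslation π σ ∧ σ R = Q)
    {α : (P ≃ P) → (P ≃ P)} (hα : IsTracePreserving π α) (hne : NonzeroE π α) {τ : P ≃ P}
    (hτ : IsTranslation π τ) (hατ : α τ = Equiv.refl P) : τ = Equiv.refl P := by
  by_contra hτ1
  obtain ⟨σ, hσ, hασ⟩ := hne
  obtain ⟨A, -⟩ := π.a3
  obtain ⟨ℓ, hℓ, hA, hτA⟩ := exists_line_through π (hτ.apply_ne hτ1 A).symm
  have hℓu : ∀ m ∈ π.lines, A ∈ m → τ A ∈ m → m = ℓ := fun m hm hAm hτm =>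
    line_eq π hm hℓ (hτ.apply_ne hτ1 A).symm hAm hτm hA hτA
  obtain ⟨X, hX⟩ := exists_notMem_line π hℓ
  obtain ⟨ρ, ⟨hρ, rfl⟩, -⟩ := huniq A X
  have hαρ := hα.eq_refl_of_direction_ne huniq hρ hτ hατ (A := A)
    fun m hm hAm hτm => hℓu m hm hAm hτm ▸ hX
  have hσ1 : σ ≠ Equiv.refl P := fun e => hασ (by rw [e, hα.1.map_refl])
  by_cases hσA : σ A ∈ ℓ
  · refine hασ (hα.eq_refl_of_direction_ne huniq hσ hρ hαρ (A := A) ?_)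
    intro m hm hAm hρm hσm
    exact hX (line_eq π hm hℓ (hσ.apply_ne hσ1 A).symm hAm hσm hA hσA ▸ hρm)
  · exact hασ (hα.eq_refl_of_direction_ne huniq hσ hτ hατ (A := A)
      fun m hm hAm hτm => hℓu m hm hAm hτm ▸ hσA)

theorem IsTracePreserving.injOn {π : AffinePlane P}
    (huniq : ∀ R Q : P, ∃! σ : P ≃ P, IsTranslation π σ ∧ σ R = Q)
    {α : (P ≃ P) → (P ≃ P)} (hα : IsTracePreserving π α) (hne : NonzeroE π α) :
    Set.InjOn α {σ | IsTranslation π σ} := by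
  intro σ hσ τ hτ h
  have hinv : IsTranslation π (τ.trans σ.symm) := hσ.symm.comp huniq hτ
  have h1 : α (τ.trans σ.symm) = Equiv.refl P := by
    rw [hα.1.2 _ _ hσ.symm hτ, ← h, ← hα.1.2 _ _ hσ.symm hσ, Equiv.self_trans_symm,
      hα.1.map_refl]
  have h2 := hα.eq_refl_of_map_eq_refl huniq hne hinv h1
  ext A
  have := DFunLike.congr_fun h2 A
  exact (σ.symm_apply_eq.mp this).symm

theorem IsTracePreserving.exists_map_eq {π : AffinePlane P}
    (huniq : ∀ R Q : P, ∃! σ : P ≃ P, IsTranslation π σ ∧ σ R = Q)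
    {α : (P ≃ P) → (P ≃ P)} (hα : IsTracePreserving π α) (hne : NonzeroE π α) {ρ : P ≃ P}
    (hρ : IsTranslation π ρ) : ∃ σ, IsTranslation π σ ∧ α σ = ρ := by
  by_cases hρ1 : ρ = Equiv.refl P
  · exact ⟨_, isTranslation_refl π, by rw [hρ1, hα.1.map_refl]⟩
  obtain ⟨A, -⟩ := π.a3
  obtain ⟨ℓ, hℓ, hA, hρA⟩ := exists_line_through π (hρ.apply_ne hρ1 A).symm
  obtain ⟨Q, hQ⟩ := exists_notMem_line π hℓ
  obtain ⟨τ, ⟨hτ, rfl⟩, -⟩ := huniq A Q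
  have hτ1 : τ ≠ Equiv.refl P := fun e => hQ (by simpa [e] using hA)
  have hατ1 : α τ ≠ Equiv.refl P := fun e =>
    hτ1 (hα.eq_refl_of_map_eq_refl huniq hne hτ e)
  have hατ := hα.1.1 τ hτ
  have hατA : (α τ) A ∉ ℓ := by
    intro h
    obtain ⟨k, hk, hAk, hτk⟩ := exists_line_through π (hτ.apply_ne hτ1 A).symm
    have := line_eq π hk hℓ (hατ.apply_ne hατ1 A).symm hAk
      (hα.2 τ hτ hατ1 A k hk hAk hτk) hA h
    exact hQ (this ▸ hτk)
  obtain ⟨n, hn, hn1, hn2⟩ := exists_line_through π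
    (show (α τ) A ≠ ρ A from fun e => hατA (e ▸ hρA))
  obtain ⟨m, hm, hτm, hpar⟩ := exists_parallel_through π (τ A) hn
  have hmeet : (m ∩ ℓ).Nonempty := by
    by_contra h
    have hmℓ : Parallel π m ℓ := Or.inr (Set.not_nonempty_iff_eq_empty.mp h)
    have := (hpar.symm.trans hn hm hℓ hmℓ).eq_of_mem hn2 hρA
    exact hατA (this ▸ hn1)
  obtain ⟨R, hRm, hRℓ⟩ := hmeet
  obtain ⟨μ, ⟨hμ, rfl⟩, -⟩ := huniq (τ A) R
  have hσ := hμ.comp huniq hτ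
  refine ⟨τ.trans μ, hσ, (hα.1.1 _ hσ).eq_of_apply_eq huniq hρ (A := A) ?_⟩
  have h1 : (α (τ.trans μ)) A ∈ ℓ := hα.apply_mem hσ hℓ hℓ (Or.inl rfl) hA hRℓ hA
  have h2 : (α (τ.trans μ)) A ∈ n := by
    rw [hα.1.2 μ τ hμ hτ]
    exact hα.apply_mem hμ hm hn hpar.symm hτm hRm hn1
  by_contra h
  exact hατA (line_eq π hn hℓ h h2 hn2 h1 hρA ▸ hn1)

/-- Assume that for any two points `R`, `Q` there is exactly one translation
taking `R` to `Q`. Then every trace-preserving endomorphism `α` different from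
the zero endomorphism has a two-sided inverse under composition: a nonzero
trace-preserving endomorphism `β` with `α ∘ β = β ∘ α = 1` (pointwise on
translations). -/
theorem exists_inverse_tracePreserving (π : AffinePlane P)
    (huniq : ∀ R Q : P, ∃! σ : P ≃ P, IsTranslation π σ ∧ σ R = Q)
    (α : (P ≃ P) → (P ≃ P)) (hα : IsTracePreserving π α)
    (hne : NonzeroE π α) :
    ∃ β : (P ≃ P) → (P ≃ P), IsTracePreserving π β ∧ NonzeroE π β ∧
      ∀ σ : P ≃ P, IsTranslation π σ →
        compE α β σ = oneE σ ∧ compE β α σ = oneE σ := by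
  have hsurj : ∀ ρ : P ≃ P, ∃ σ, IsTranslation π ρ → IsTranslation π σ ∧ α σ = ρ := by
    intro ρ
    by_cases hρ : IsTranslation π ρ
    · exact (hα.exists_map_eq huniq hne hρ).imp fun _ h _ => h
    · exact ⟨ρ, fun h => absurd h hρ⟩
  choose β hβ using hsurj
  have hinj := hα.injOn huniq hne
  have hβα : ∀ σ, IsTranslation π σ → β (α σ) = σ := fun σ hσ =>
    have h := hβ _ (hα.1.1 σ hσ)
    hinj h.1 hσ h.2
  refine ⟨β, ⟨⟨fun σ hσ => (hβ σ hσ).1, fun σ τ hσ hτ => ?_⟩, ?_⟩, ?_,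
    fun σ hσ => ⟨(hβ σ hσ).2, hβα σ hσ⟩⟩
  · have h := hβ _ (hσ.comp huniq hτ)
    refine hinj h.1 ((hβ σ hσ).1.comp huniq (hβ τ hτ).1) ?_
    rw [h.2, hα.1.2 _ _ (hβ σ hσ).1 (hβ τ hτ).1, (hβ σ hσ).2, (hβ τ hτ).2]
  · intro σ hσ h1 A ℓ hℓ hA hσA
    obtain ⟨hτ, hατ⟩ := hβ σ hσ
    have hσ1 : σ ≠ Equiv.refl P := fun e =>
      h1 (hα.eq_refl_of_map_eq_refl huniq hne hτ (hατ.trans e))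
    obtain ⟨m, hm, hAm, hτm⟩ := exists_line_through π (hτ.apply_ne h1 A).symm
    have hσm : σ A ∈ m := by
      have := hα.2 _ hτ (by rwa [hατ]) A m hm hAm hτm
      rwa [hατ] at this
    exact line_eq π hm hℓ (hσ.apply_ne hσ1 A).symm hAm hσm hA hσA ▸ hτm
  · obtain ⟨σ, hσ, hσ1⟩ := hne
    refine ⟨α σ, hα.1.1 σ hσ, fun e => hσ1 ?_⟩
    rw [← hβα σ hσ, e, hα.1.map_refl]

end AffinePlane
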